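/- For any point placement P of n points, the sum over all 3-element subsets T of P of the binomial coefficient C(β_T, 2) equals U(P) + 3·T₂(P). -/

import Mathlib

open Finset

/-- A finite set of points in the plane is in *general position* if no three of
its points are collinear. -/
def GenPos (P : Finset (ℝ × ℝ)) : Prop :=
  ∀ x ∈ P, ∀ y ∈ P, ∀ z ∈ P, x ≠ y → x ≠ z → y ≠ z →
    ¬ Collinear ℝ ({x, y, z} : Set (ℝ × ℝ))

/-- A finite set of points is in *convex position* if every point of it is an
extreme point of its convex hull. -/
def ConvexPos (S : Finset (ℝ × ℝ)) : Prop :=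
  ∀ x ∈ S, x ∈ Set.extremePoints ℝ (convexHull ℝ (S : Set (ℝ × ℝ)))

open scoped Classical in
/-- Number of `k`-element subsets of `P` that are in convex position. -/
noncomputable def convexPosCount (P : Finset (ℝ × ℝ)) (k : ℕ) : ℕ :=
  ((P.powersetCard k).filter fun S => ConvexPos S).card

/-- `mu k n` is the minimum number of `k`-element subsets in convex position over
all placements of `n` points in general position. -/
noncomputable def mu (k n : ℕ) : ℕ :=
  sInf {m | ∃ P : Finset (ℝ × ℝ), GenPos P ∧ P.card = n ∧ convexPosCount P k = m}

/-- `x` is a γ-point of `T` if `T ∪ {x}` is in convex position. -/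
def IsGammaPt (T : Finset (ℝ × ℝ)) (x : ℝ × ℝ) : Prop :=
  ConvexPos (insert x T)

/-- `x` is a β-point of `T` if `T ∪ {x}` is not in convex position and `x` does not
lie in the convex hull of `T`. -/
def IsBetaPt (T : Finset (ℝ × ℝ)) (x : ℝ × ℝ) : Prop :=
  ¬ ConvexPos (insert x T) ∧ x ∉ convexHull ℝ (T : Set (ℝ × ℝ))

open scoped Classical in
/-- `γ_T`: number of γ-points of `T` among the points of `P \ T`. -/
noncomputable def gammaCount (P T : Finset (ℝ × ℝ)) : ℕ :=
  ((P \ T).filter fun x => IsGammaPt T x).card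

open scoped Classical in
/-- `β_T`: number of β-points of `T` among the points of `P \ T`. -/
noncomputable def betaCount (P T : Finset (ℝ × ℝ)) : ℕ :=
  ((P \ T).filter fun x => IsBetaPt T x).card

open scoped Classical in
/-- Number of `k`-element subsets of `P` whose convex hull has exactly `j`
extreme points. -/
noncomputable def hullCount (P : Finset (ℝ × ℝ)) (k j : ℕ) : ℕ :=
  ((P.powersetCard k).filter fun S =>
    (Set.extremePoints ℝ (convexHull ℝ (S : Set (ℝ × ℝ)))).ncard = j).card

/-- `x` and `y` lie strictly on the same side of the line through `p` and `q`. -/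
def SameSide (p q x y : ℝ × ℝ) : Prop :=
  0 < ((q.1 - p.1) * (x.2 - p.2) - (q.2 - p.2) * (x.1 - p.1)) *
      ((q.1 - p.1) * (y.2 - p.2) - (q.2 - p.2) * (y.1 - p.1))

/-- `x` and `y` lie in the same region with respect to `T`: for each pair of
distinct points of `T`, they lie strictly on the same side of the line through them. -/
def SameRegion (T : Finset (ℝ × ℝ)) (x y : ℝ × ℝ) : Prop :=
  ∀ p ∈ T, ∀ q ∈ T, p ≠ q → SameSide p q x y

open scoped Classical in
/-- Number of 2-element subsets `{x, y}` of `P \ T` such that `x` and `y` are both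
γ-points of `T` lying in the same region with respect to `T`. -/
noncomputable def gammaSamePairs (P T : Finset (ℝ × ℝ)) : ℕ :=
  (((P \ T).powersetCard 2).filter fun S =>
    (∀ x ∈ S, IsGammaPt T x) ∧ ∀ x ∈ S, ∀ y ∈ S, x ≠ y → SameRegion T x y).card

open scoped Classical in
/-- Number of 2-element subsets `{x, y}` of `P \ T` such that `x` and `y` are both
γ-points of `T` lying in distinct regions with respect to `T`. -/
noncomputable def gammaDiffPairs (P T : Finset (ℝ × ℝ)) : ℕ :=
  (((P \ T).powersetCard 2).filter fun S =>
    (∀ x ∈ S, IsGammaPt T x) ∧ ∀ x ∈ S, ∀ y ∈ S, x ≠ y → ¬ SameRegion T x y).card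

open scoped Classical in
/-- Number of 2-element subsets `{x, y}` of `P \ T` such that `x` and `y` are both
β-points of `T` lying in the same region with respect to `T`. -/
noncomputable def betaSamePairs (P T : Finset (ℝ × ℝ)) : ℕ :=
  (((P \ T).powersetCard 2).filter fun S =>
    (∀ x ∈ S, IsBetaPt T x) ∧ ∀ x ∈ S, ∀ y ∈ S, x ≠ y → SameRegion T x y).card

open scoped Classical in
/-- Number of 2-element subsets `{x, y}` of `P \ T` such that `x` and `y` are both
β-points of `T` lying in distinct regions with respect to `T`. -/
noncomputable def betaDiffPairs (P T : Finset (ℝ × ℝ)) : ℕ :=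
  (((P \ T).powersetCard 2).filter fun S =>
    (∀ x ∈ S, IsBetaPt T x) ∧ ∀ x ∈ S, ∀ y ∈ S, x ≠ y → ¬ SameRegion T x y).card

/-- Twice the signed area of the triangle `abc`. -/
def signedArea (a b c : ℝ × ℝ) : ℝ :=
  (b.1 - a.1) * (c.2 - a.2) - (b.2 - a.2) * (c.1 - a.1)

theorem collinear_of_signedArea_eq_zero {a b c : ℝ × ℝ} (h : signedArea a b c = 0) :
    Collinear ℝ ({a, b, c} : Set (ℝ × ℝ)) := by
  unfold signedArea at h
  by_cases hab : b = a
  · subst hab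
    simpa using collinear_pair ℝ b c
  · have key : ∃ r : ℝ, c = r • (b - a) +ᵥ a := by
      by_cases h1 : b.1 - a.1 = 0
      · have h2 : b.2 - a.2 ≠ 0 := fun h2 => hab (Prod.ext (by linarith) (by linarith))
        refine ⟨(c.2 - a.2) / (b.2 - a.2), Prod.ext ?_ ?_⟩
        · have : c.1 - a.1 = 0 := by
            rw [h1] at h
            have : (b.2 - a.2) * (c.1 - a.1) = 0 := by linarith
            exact (mul_eq_zero.1 this).resolve_left h2
          simp [h1]
          linarith
        · simp [h2]
      · refine ⟨(c.1 - a.1) / (b.1 - a.1), Prod.ext ?_ ?_⟩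
        · simp [h1]
        · simp only [vadd_eq_add, Prod.snd_add, Prod.smul_snd, Prod.snd_sub, smul_eq_mul]
          field_simp
          linarith
    obtain ⟨r, hr⟩ := key
    rw [collinear_iff_of_mem (p₀ := a) (by simp)]
    refine ⟨b - a, ?_⟩
    simp only [Set.mem_insert_iff, Set.mem_singleton_iff, forall_eq_or_imp, forall_eq]
    exact ⟨⟨0, by simp⟩, ⟨1, by simp⟩, r, hr⟩

theorem signedArea_rotate (a b c : ℝ × ℝ) : signedArea b c a = signedArea a b c := by
  unfold signedArea; ring

theorem signedArea_swap (a b c : ℝ × ℝ) : signedArea b a c = -signedArea a b c := by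
  unfold signedArea; ring

theorem mem_convexHull_triple_iff {a b c x : ℝ × ℝ} :
    x ∈ convexHull ℝ ({a, b, c} : Set (ℝ × ℝ)) ↔
      ∃ u v w : ℝ, 0 ≤ u ∧ 0 ≤ v ∧ 0 ≤ w ∧ u + v + w = 1 ∧ u • a + v • b + w • c = x := by
  constructor
  · rw [convexHull_insert (by simp), convexHull_pair]
    intro h
    simp only [mem_convexJoin, Set.mem_singleton_iff, exists_eq_left] at h
    obtain ⟨y, ⟨s, t, hs, ht, hst, rfl⟩, s', t', hs', ht', hst', rfl⟩ := h
    refine ⟨s', t' * s, t' * t, hs', by positivity, by positivity, ?_, ?_⟩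
    · linear_combination hst' + t' * hst
    · simp only [smul_add, smul_smul, add_assoc]
  · rintro ⟨u, v, w, hu, hv, hw, h1, rfl⟩
    have hs := subset_convexHull ℝ ({a, b, c} : Set (ℝ × ℝ))
    have := (convex_convexHull ℝ ({a, b, c} : Set (ℝ × ℝ))).sum_mem (t := Finset.univ)
      (w := ![u, v, w]) (z := ![a, b, c]) (by simp [Fin.forall_fin_succ, hu, hv, hw])
      (by simp [Fin.sum_univ_succ, ← add_assoc, h1])
      (by simp [Fin.forall_fin_succ, hs (show a ∈ _ by simp), hs (show b ∈ _ by simp),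
        hs (show c ∈ _ by simp)])
    simpa [Fin.sum_univ_succ, add_assoc] using this

theorem mem_convexHull_triple_iff_signedArea {a b c x : ℝ × ℝ} (hc : signedArea a b x ≠ 0)
    (ha : signedArea b c x ≠ 0) (hb : signedArea c a x ≠ 0) :
    x ∈ convexHull ℝ ({a, b, c} : Set (ℝ × ℝ)) ↔
      (0 < signedArea a b x ↔ 0 < signedArea b c x) ∧
        (0 < signedArea b c x ↔ 0 < signedArea c a x) := by
  have hsum : signedArea b c x + signedArea c a x + signedArea a b x = signedArea a b c := by
    unfold signedArea; ring
  rw [mem_convexHull_triple_iff]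
  constructor
  · rintro ⟨u, v, w, hu, hv, hw, h1, rfl⟩
    obtain rfl : u = 1 - v - w := by linarith
    have e1 : signedArea a b ((1 - v - w) • a + v • b + w • c) = w * signedArea a b c := by
      simp [signedArea]; ring
    have e2 : signedArea b c ((1 - v - w) • a + v • b + w • c)
        = (1 - v - w) * signedArea a b c := by
      simp [signedArea]; ring
    have e3 : signedArea c a ((1 - v - w) • a + v • b + w • c) = v * signedArea a b c := by
      simp [signedArea]; ring
    rw [e1] at hc ⊢
    rw [e2] at ha ⊢
    rw [e3] at hb ⊢
    have hw' := lt_of_le_of_ne hw (left_ne_zero_of_mul hc).symm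
    have hu' := lt_of_le_of_ne hu (left_ne_zero_of_mul ha).symm
    have hv' := lt_of_le_of_ne hv (left_ne_zero_of_mul hb).symm
    simp only [mul_pos_iff_of_pos_left hw', mul_pos_iff_of_pos_left hu',
      mul_pos_iff_of_pos_left hv', and_self]
  · rintro ⟨h1, h2⟩
    have hx : signedArea a b c ≠ 0 →
        (signedArea b c x / signedArea a b c) • a + (signedArea c a x / signedArea a b c) • b +
          (signedArea a b x / signedArea a b c) • c = x := by
      intro h
      refine Prod.ext ?_ ?_ <;> simp <;> field_simp <;> unfold signedArea <;> ring
    have hone : signedArea a b c ≠ 0 → signedArea b c x / signedArea a b c +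
        signedArea c a x / signedArea a b c + signedArea a b x / signedArea a b c = 1 := by
      intro h
      field_simp
      exact hsum
    by_cases hp : 0 < signedArea b c x
    · have p1 := h1.2 hp
      have p2 := h2.1 hp
      have p3 : 0 < signedArea a b c := by linarith
      exact ⟨_, _, _, by positivity, by positivity, by positivity, hone p3.ne', hx p3.ne'⟩
    · have n1 := lt_of_le_of_ne (not_lt.1 (mt h1.1 hp)) hc
      have n2 := lt_of_le_of_ne (not_lt.1 (mt h2.2 hp)) hb
      have n3 := lt_of_le_of_ne (not_lt.1 hp) ha
      have n4 : signedArea a b c < 0 := by linarith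
      exact ⟨_, _, _, div_nonneg_of_nonpos n3.le n4.le, div_nonneg_of_nonpos n2.le n4.le,
        div_nonneg_of_nonpos n1.le n4.le, hone n4.ne, hx n4.ne⟩

theorem mem_extremePoints_convexHull_iff {E : Type*} [AddCommGroup E] [Module ℝ E] {s : Set E}
    {x : E} :
    x ∈ Set.extremePoints ℝ (convexHull ℝ s) ↔ x ∈ s ∧ x ∉ convexHull ℝ (s \ {x}) := by
  constructor
  · intro h
    refine ⟨extremePoints_convexHull_subset h, fun hx => ?_⟩
    rw [(convex_convexHull ℝ s).mem_extremePoints_iff_mem_sdiff_convexHull_sdiff] at h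
    exact h.2 (convexHull_mono (Set.sdiff_subset_sdiff_left (subset_convexHull ℝ s)) hx)
  · rintro ⟨hxs, hx⟩
    refine ⟨subset_convexHull ℝ s hxs, ?_⟩
    have hs : insert x (s \ {x}) = s := by simp [hxs]
    have hrep : ∀ y ∈ convexHull ℝ s, y ≠ x →
        ∃ z ∈ convexHull ℝ (s \ {x}), ∃ r : ℝ, 0 < r ∧ y - x = r • (z - x) := by
      intro y hy hyx
      rcases (s \ {x}).eq_empty_or_nonempty with he | hne
      · rw [← hs, he] at hy
        simp at hy
        exact absurd hy hyx
      rw [← hs, convexHull_insert hne] at hy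
      simp only [mem_convexJoin, Set.mem_singleton_iff, exists_eq_left] at hy
      obtain ⟨z, hz, a, b, ha, hb, hab, rfl⟩ := hy
      refine ⟨z, hz, b, lt_of_le_of_ne hb ?_, ?_⟩
      · rintro rfl
        apply hyx
        obtain rfl : a = 1 := by linarith
        simp
      · obtain rfl : a = 1 - b := by linarith
        module
    intro y hy z hz hxyz
    by_contra hne
    obtain ⟨a, b, ha, hb, hab, hx'⟩ := hxyz
    obtain rfl : a = 1 - b := by linarith
    have hcomb : (1 - b) • (y - x) + b • (z - x) = 0 := by
      rw [← sub_eq_zero] at hx'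
      rw [← hx']
      module
    have hzx : z ≠ x := by
      rintro rfl
      rw [sub_self, smul_zero, add_zero, smul_eq_zero, sub_eq_zero] at hcomb
      exact hcomb.elim (fun h => by linarith) (sub_ne_zero.2 hne)
    obtain ⟨y', hy', r, hr, hyr⟩ := hrep y hy hne
    obtain ⟨z', hz', t, ht, hzt⟩ := hrep z hz hzx
    rw [hyr, hzt, smul_smul, smul_smul] at hcomb
    have hpos : 0 < (1 - b) * r + b * t := by positivity
    refine hx ?_
    convert (convex_convexHull ℝ (s \ {x})) hy' hz'
      (a := (1 - b) * r / ((1 - b) * r + b * t)) (b := b * t / ((1 - b) * r + b * t))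
      (by positivity) (by positivity) (by field_simp) using 1
    have hy2 : ((1 - b) * r + b * t) • x = ((1 - b) * r) • y' + (b * t) • z' := by
      rw [← sub_eq_zero, ← neg_eq_zero, ← hcomb]
      module
    rw [div_eq_inv_mul, div_eq_inv_mul, mul_smul _ ((1 - b) * r), mul_smul _ (b * t),
      ← smul_add, ← hy2, inv_smul_smul₀ hpos.ne']

/-- In the plane, a point of the convex hull of a finite set with at least three points lies in
the convex hull of three of them. -/
theorem mem_convexHull_iff_exists_card_three {s : Finset (ℝ × ℝ)} (hs : 3 ≤ s.card)
    {x : ℝ × ℝ} :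
    x ∈ convexHull ℝ (s : Set (ℝ × ℝ)) ↔
      ∃ t ⊆ s, t.card = 3 ∧ x ∈ convexHull ℝ (t : Set (ℝ × ℝ)) := by
  constructor
  · intro h
    rw [convexHull_eq_union] at h
    simp only [Set.mem_iUnion] at h
    obtain ⟨t, hts, hai, hx⟩ := h
    have hcard := hai.card_le_finrank_succ
    have hle : Module.finrank ℝ (vectorSpan ℝ (Set.range ((↑) : t → ℝ × ℝ))) ≤ 2 := by
      have := Submodule.finrank_le (vectorSpan ℝ (Set.range ((↑) : t → ℝ × ℝ)))
      simpa using this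
    rw [Fintype.card_coe] at hcard
    obtain ⟨u, htu, hus, hu⟩ :=
      Finset.exists_subsuperset_card_eq (n := 3) (by exact_mod_cast hts) (by omega) hs
    exact ⟨u, hus, hu, convexHull_mono (by exact_mod_cast htu) hx⟩
  · rintro ⟨t, hts, -, hx⟩
    exact convexHull_mono (by exact_mod_cast hts) hx

/-- Given the orientations of the triples `bcd`, `acd`, `abd`, `abc` of four points `a`, `b`,
`c`, `d`, tells which of the four points lie inside the triangle spanned by the other three. -/
def innerOfSigns (bcd acd abd abc : Bool) : Fin 4 → Bool :=
  ![abc == acd && acd != abd, bcd == abd && abd != abc,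
    abc == acd && bcd != acd, abd == bcd && bcd != acd]

/-- The entry at `(m, i)` tells whether point `i` lies inside the triangle spanned by the three
points other than `m` and `i`, among five points whose triples `ijk` have orientation `sijk`. -/
def innerTable (s012 s013 s014 s023 s024 s034 s123 s124 s134 s234 : Bool) (m : Fin 5) :
    Fin 5 → Bool :=
  m.insertNth false (innerOfSigns
    (![s234, s234, s134, s124, s123] m) (![s134, s034, s034, s024, s023] m)
    (![s124, s024, s014, s014, s013] m) (![s123, s023, s013, s012, s012] m))

/-- The orientations of the triples `bcd`, `acd`, `abd`, `abc` of four points are compatible with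
the affine relation between the signed areas. -/
def AffineCompatible (bcd acd abd abc : Bool) : Prop :=
  ¬ (bcd = abd ∧ acd = abc ∧ bcd ≠ acd)

instance (a b c d : Bool) : Decidable (AffineCompatible a b c d) :=
  inferInstanceAs (Decidable (¬ _))

/-- The signs of six reals are compatible with `a * b - c * d + e * f = 0`. -/
def PluckerCompatible (x x' y y' z z' : Bool) : Prop :=
  ¬ ((x == x') = (z == z') ∧ (x == x') ≠ (y == y'))

instance (a a' b b' c c' : Bool) : Decidable (PluckerCompatible a a' b b' c c') :=
  inferInstanceAs (Decidable (¬ _))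

theorem affineCompatible_decide {x y z w : ℝ} (h : x - y + z - w = 0) (hx : x ≠ 0) (hy : y ≠ 0)
    (hz : z ≠ 0) (hw : w ≠ 0) :
    AffineCompatible (decide (0 < x)) (decide (0 < y)) (decide (0 < z)) (decide (0 < w)) := by
  rintro ⟨h1, h2, h3⟩
  simp only [decide_eq_decide, ne_eq] at h1 h2 h3
  rcases hx.lt_or_gt with hx | hx <;> rcases hy.lt_or_gt with hy | hy <;>
    rcases hz.lt_or_gt with hz | hz <;> rcases hw.lt_or_gt with hw | hw <;>
    simp only [hx, hy, hz, hw, hx.not_gt, hy.not_gt, hz.not_gt, hw.not_gt, not_true_eq_false,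
      iff_true, iff_false, not_false_eq_true] at h1 h2 h3 <;>
    linarith

theorem decide_pos_beq {x y : ℝ} (hx : x ≠ 0) (hy : y ≠ 0) :
    (decide (0 < x) == decide (0 < y)) = decide (0 < x * y) := by
  rcases hx.lt_or_gt with hx | hx <;> rcases hy.lt_or_gt with hy | hy <;>
    simp [hx, hy, hx.not_gt, hy.not_gt, mul_pos_iff]

theorem pluckerCompatible_decide {x x' y y' z z' : ℝ} (h : x * x' - y * y' + z * z' = 0)
    (hx : x ≠ 0) (hx' : x' ≠ 0) (hy : y ≠ 0) (hy' : y' ≠ 0) (hz : z ≠ 0) (hz' : z' ≠ 0) :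
    PluckerCompatible (decide (0 < x)) (decide (0 < x')) (decide (0 < y)) (decide (0 < y'))
      (decide (0 < z)) (decide (0 < z')) := by
  unfold PluckerCompatible
  rw [decide_pos_beq hx hx', decide_pos_beq hy hy', decide_pos_beq hz hz']
  rintro ⟨h1, h2⟩
  simp only [decide_eq_decide, ne_eq] at h1 h2
  have hx := mul_ne_zero hx hx'
  have hy := mul_ne_zero hy hy'
  have hz := mul_ne_zero hz hz'
  by_cases hpx : 0 < x * x'
  · have hpz := h1.1 hpx
    have : y * y' ≤ 0 := not_lt.1 fun hpy => h2 ⟨fun _ => hpy, fun _ => hpx⟩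
    linarith
  · have hpz := mt h1.2 hpx
    have hpy : 0 < y * y' := not_not.1 fun hpy => h2 ⟨fun h => absurd h hpx, fun h => absurd h hpy⟩
    linarith

theorem card_filter_innerTable : ∀ s012 s013 s014 s023 s024 s034 s123 s124 s134 s234 : Bool,
    AffineCompatible s234 s134 s124 s123 → AffineCompatible s234 s034 s024 s023 →
    AffineCompatible s134 s034 s014 s013 → AffineCompatible s124 s024 s014 s012 →
    AffineCompatible s123 s023 s013 s012 →
    PluckerCompatible s012 s034 s013 s024 s014 s023 →
    PluckerCompatible s012 s134 s013 s124 s014 s123 →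
    PluckerCompatible s012 s234 s023 s124 s024 s123 →
    PluckerCompatible s013 s234 s023 s134 s034 s123 →
    PluckerCompatible s014 s234 s024 s134 s034 s124 →
    let h := innerTable s012 s013 s014 s023 s024 s034 s123 s124 s134 s234
    ((powersetCard 3 univ).filter fun U : Finset (Fin 5) =>
      ∀ i ∉ U, ∀ m ∉ U, m ≠ i → (∃ j, h m j) ∧ ¬ h m i).card =
        (if (univ.filter fun i => ∀ m, ¬ h m i).card = 4 then 1 else 0) +
          3 * (if (univ.filter fun i => ∀ m, ¬ h m i).card = 3 then 1 else 0) := by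
  decide +kernel

theorem innerOfSigns_eq_true_iff {a b c d : ℝ × ℝ} (ha : signedArea b c d ≠ 0)
    (hb : signedArea a c d ≠ 0) (hc : signedArea a b d ≠ 0) (hd : signedArea a b c ≠ 0) (k : Fin 4) :
    innerOfSigns (decide (0 < signedArea b c d)) (decide (0 < signedArea a c d))
        (decide (0 < signedArea a b d)) (decide (0 < signedArea a b c)) k = true ↔
      ![a, b, c, d] k ∈ convexHull ℝ
        (![{b, c, d}, {a, c, d}, {a, b, d}, {a, b, c}] k : Set (ℝ × ℝ)) := by
  have neg_pos_iff {x : ℝ} (hx : x ≠ 0) : 0 < -x ↔ ¬ 0 < x := by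
    rw [neg_pos, not_lt, le_iff_lt_or_eq, or_iff_left hx]
  have abc := signedArea_rotate a b c
  have acd := signedArea_rotate a c d
  have bcd := signedArea_rotate b c d
  have abd : signedArea d a b = signedArea a b d := (signedArea_rotate d a b).symm
  have dac : signedArea d a c = signedArea a c d := (signedArea_rotate d a c).symm
  have acb : signedArea a c b = -signedArea a b c := by unfold signedArea; ring
  have bdc : signedArea b d c = -signedArea b c d := by unfold signedArea; ring
  have cad : signedArea c a d = -signedArea a c d := signedArea_swap a c d
  have dba : signedArea d b a = -signedArea a b d := by unfold signedArea; ring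
  have key (k : Fin 4) : ![a, b, c, d] k ∈ convexHull ℝ
        (![{b, c, d}, {a, c, d}, {a, b, d}, {a, b, c}] k : Set (ℝ × ℝ)) ↔
      (0 < ![signedArea b c a, signedArea a c b, signedArea a b c, signedArea a b d] k ↔
        0 < ![signedArea c d a, signedArea c d b, signedArea b d c, signedArea b c d] k) ∧
      (0 < ![signedArea c d a, signedArea c d b, signedArea b d c, signedArea b c d] k ↔
        0 < ![signedArea d b a, signedArea d a b, signedArea d a c, signedArea c a d] k) := by
    fin_cases k <;> apply mem_convexHull_triple_iff_signedArea <;>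
      simp [abc, acd, bcd, abd, dac, acb, bdc, cad, dba, ha, hb, hc, hd]
  rw [key, abc, acd, bcd, abd, dac, acb, bdc, cad, dba]
  fin_cases k <;>
    simp [innerOfSigns, neg_pos_iff, ha, hb, hc, hd, -Left.neg_pos_iff] <;> grind

open scoped Classical in
/-- Among five points `p`, whether `p i` lies in the triangle of the three points other than
`p m` and `p i`. -/
noncomputable def insideTriangle (p : Fin 5 → ℝ × ℝ) (m i : Fin 5) : Bool :=
  decide (m ≠ i ∧ p i ∈ convexHull ℝ (p '' ({m, i}ᶜ : Finset (Fin 5))))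

theorem insideTriangle_iff {p : Fin 5 → ℝ × ℝ} {m i : Fin 5} :
    insideTriangle p m i = true ↔ m ≠ i ∧ p i ∈ convexHull ℝ (p '' ({m, i}ᶜ : Finset (Fin 5))) := by
  simp only [insideTriangle, decide_eq_true_eq]

/-- Whether the triangle `p i`, `p j`, `p k` is positively oriented. -/
noncomputable def positiveTriple (p : Fin 5 → ℝ × ℝ) (i j k : Fin 5) : Bool :=
  decide (0 < signedArea (p i) (p j) (p k))

section FivePoints

variable {p : Fin 5 → ℝ × ℝ}

theorem insideTriangle_succAbove
    (hp : ∀ i j k, i < j → j < k → signedArea (p i) (p j) (p k) ≠ 0) (m : Fin 5) (k : Fin 4) :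
    insideTriangle p m (m.succAbove k) = innerOfSigns
      (positiveTriple p (m.succAbove 1) (m.succAbove 2) (m.succAbove 3))
      (positiveTriple p (m.succAbove 0) (m.succAbove 2) (m.succAbove 3))
      (positiveTriple p (m.succAbove 0) (m.succAbove 1) (m.succAbove 3))
      (positiveTriple p (m.succAbove 0) (m.succAbove 1) (m.succAbove 2)) k := by
  have hs : ∀ i j k : Fin 4, i < j → j < k →
      signedArea (p (m.succAbove i)) (p (m.succAbove j)) (p (m.succAbove k)) ≠ 0 :=
    fun i j k hij hjk =>
      hp _ _ _ (m.strictMono_succAbove hij) (m.strictMono_succAbove hjk)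
  have hset : ({m, m.succAbove k}ᶜ : Finset (Fin 5)) =
      ({k}ᶜ : Finset (Fin 4)).map m.succAboveEmb := by
    clear hs hp
    decide +revert
  rw [Bool.eq_iff_iff, insideTriangle_iff, and_iff_right (m.succAbove_ne k).symm, hset]
  simp only [positiveTriple]
  rw [innerOfSigns_eq_true_iff (hs _ _ _ (by decide) (by decide)) (hs _ _ _ (by decide) (by decide))
    (hs _ _ _ (by decide) (by decide)) (hs _ _ _ (by decide) (by decide))]
  have h0 : ({0}ᶜ : Finset (Fin 4)) = {1, 2, 3} := by decide
  have h1 : ({1}ᶜ : Finset (Fin 4)) = {0, 2, 3} := by decide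
  have h2 : ({2}ᶜ : Finset (Fin 4)) = {0, 1, 3} := by decide
  have h3 : ({3}ᶜ : Finset (Fin 4)) = {0, 1, 2} := by decide
  clear hset
  fin_cases k <;>
    simp only [Fin.zero_eta, Fin.mk_one, Fin.reduceFinMk, h0, h1, h2, h3, Finset.coe_map,
      Finset.coe_insert, Finset.coe_singleton, Set.image_insert_eq, Set.image_singleton] <;>
    rfl

theorem insideTriangle_eq_innerTable
    (hp : ∀ i j k, i < j → j < k → signedArea (p i) (p j) (p k) ≠ 0) :
    insideTriangle p = innerTable (positiveTriple p 0 1 2) (positiveTriple p 0 1 3)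
      (positiveTriple p 0 1 4) (positiveTriple p 0 2 3) (positiveTriple p 0 2 4)
      (positiveTriple p 0 3 4) (positiveTriple p 1 2 3) (positiveTriple p 1 2 4)
      (positiveTriple p 1 3 4) (positiveTriple p 2 3 4) := by
  funext m i
  rcases Fin.eq_self_or_eq_succAbove m i with rfl | ⟨k, rfl⟩
  · simp [insideTriangle, innerTable]
  · rw [insideTriangle_succAbove hp, innerTable, Fin.insertNth_apply_succAbove]
    fin_cases m <;> rfl

theorem card_filter_insideTriangle
    (hp : ∀ i j k, i < j → j < k → signedArea (p i) (p j) (p k) ≠ 0) :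
    ((powersetCard 3 univ).filter fun U : Finset (Fin 5) =>
      ∀ i ∉ U, ∀ m ∉ U, m ≠ i →
        (∃ j, insideTriangle p m j) ∧ ¬ insideTriangle p m i).card =
        (if (univ.filter fun i => ∀ m, ¬ insideTriangle p m i).card = 4 then 1 else 0) +
          3 * (if (univ.filter fun i => ∀ m, ¬ insideTriangle p m i).card = 3 then 1 else 0) := by
  rw [insideTriangle_eq_innerTable hp]
  apply card_filter_innerTable
  iterate 5
    refine affineCompatible_decide (by unfold signedArea; ring) ?_ ?_ ?_ ?_ <;>
      exact hp _ _ _ (by decide) (by decide)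
  all_goals
    refine pluckerCompatible_decide (by unfold signedArea; ring) ?_ ?_ ?_ ?_ ?_ ?_ <;>
      exact hp _ _ _ (by decide) (by decide)

end FivePoints

theorem convexPos_iff {S : Finset (ℝ × ℝ)} :
    ConvexPos S ↔ ∀ x ∈ S, x ∉ convexHull ℝ ((S : Set (ℝ × ℝ)) \ {x}) := by
  simp only [ConvexPos, mem_extremePoints_convexHull_iff, Finset.mem_coe]
  exact forall₂_congr fun x hx => and_iff_right hx

theorem isBetaPt_map_iff {p : Fin 5 ↪ ℝ × ℝ} {U : Finset (Fin 5)} (hU : U.card = 3)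
    {i m : Fin 5} (hi : i ∉ U) (hm : m ∉ U) (hmi : m ≠ i) :
    IsBetaPt (U.map p) (p i) ↔ (∃ j, insideTriangle p m j) ∧ ¬ insideTriangle p m i := by
  obtain rfl : U = {m, i}ᶜ := by decide +revert
  have hins : insert (p i) (({m, i}ᶜ : Finset (Fin 5)).map p) = ({m}ᶜ : Finset (Fin 5)).map p := by
    rw [← Finset.map_insert]
    congr 1
    decide +revert
  have hdiff (j : Fin 5) : ((({m}ᶜ : Finset (Fin 5)).map p : Finset (ℝ × ℝ)) : Set (ℝ × ℝ)) \ {p j} =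
      p '' ({m, j}ᶜ : Finset (Fin 5)) := by
    ext x
    simp only [Finset.coe_map, Set.mem_sdiff, Set.mem_image, Finset.mem_coe, Finset.mem_compl,
      Finset.mem_singleton, Finset.mem_insert, Set.mem_singleton_iff, not_or]
    constructor
    · rintro ⟨⟨k, hk, rfl⟩, hkj⟩
      exact ⟨k, ⟨hk, fun h => hkj (by rw [h])⟩, rfl⟩
    · rintro ⟨k, ⟨hk, hkj⟩, rfl⟩
      exact ⟨⟨k, hk, rfl⟩, fun h => hkj (p.injective h)⟩
  rw [IsBetaPt, hins, convexPos_iff]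
  simp only [Finset.forall_mem_map, hdiff, insideTriangle_iff, Finset.mem_compl,
    Finset.mem_singleton, not_forall, not_not, Finset.coe_map p {m, i}ᶜ, hmi, ne_eq,
    not_false_eq_true, true_and, exists_prop, eq_comm (a := m)]

theorem mem_convexHull_range_diff_iff {p : Fin 5 ↪ ℝ × ℝ} {i : Fin 5} :
    p i ∈ convexHull ℝ (Set.range p \ {p i}) ↔ ∃ m, insideTriangle p m i := by
  have hrange : Set.range p \ {p i} = ((({i}ᶜ : Finset (Fin 5)).map p : Finset (ℝ × ℝ)) : Set _) := by
    ext x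
    simp only [Set.mem_sdiff, Set.mem_range, Set.mem_singleton_iff, Finset.coe_map, Set.mem_image,
      Finset.mem_coe, Finset.mem_compl, Finset.mem_singleton]
    constructor
    · rintro ⟨⟨k, rfl⟩, hk⟩
      exact ⟨k, fun h => hk (by rw [h]), rfl⟩
    · rintro ⟨k, hk, rfl⟩
      exact ⟨⟨k, rfl⟩, fun h => hk (p.injective h)⟩
  rw [hrange, mem_convexHull_iff_exists_card_three (by simp [Finset.card_compl])]
  simp only [insideTriangle_iff, ← Finset.coe_map]
  constructor
  · rintro ⟨t, ht, hcard, hx⟩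
    obtain ⟨U, hU, rfl⟩ := Finset.subset_map_iff.1 ht
    rw [Finset.card_map] at hcard
    obtain ⟨m, hm, rfl⟩ : ∃ m, m ≠ i ∧ U = {m, i}ᶜ := by
      clear hx ht hrange
      decide +revert
    exact ⟨m, hm, hx⟩
  · rintro ⟨m, hm, hx⟩
    refine ⟨_, Finset.map_subset_map.2 ?_, ?_, hx⟩
    · simp
    · rw [Finset.card_map, Finset.card_compl, Finset.card_pair hm, Fintype.card_fin]

theorem ncard_extremePoints_map (p : Fin 5 ↪ ℝ × ℝ) :
    (Set.extremePoints ℝ (convexHull ℝ ((univ.map p : Finset (ℝ × ℝ)) : Set (ℝ × ℝ)))).ncard =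
      (univ.filter fun i => ∀ m, ¬ insideTriangle p m i).card := by
  rw [← Finset.card_map p, ← Set.ncard_coe_finset]
  congr 1
  ext x
  rw [mem_extremePoints_convexHull_iff]
  simp only [Finset.coe_map, Finset.coe_univ, Set.image_univ, Finset.coe_filter, Finset.mem_univ,
    true_and, Set.mem_image, Set.mem_ofPred_eq]
  constructor
  · rintro ⟨⟨i, rfl⟩, hi⟩
    rw [mem_convexHull_range_diff_iff, not_exists] at hi
    exact ⟨i, hi, rfl⟩
  · rintro ⟨i, hi, rfl⟩
    exact ⟨⟨i, rfl⟩, by rwa [mem_convexHull_range_diff_iff, not_exists]⟩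

theorem exists_map_univ_eq_of_card {α : Type*} {n : ℕ} {S : Finset α} (hS : S.card = n) :
    ∃ p : Fin n ↪ α, univ.map p = S := by
  refine ⟨(S.equivFinOfCardEq hS).symm.toEmbedding.trans (Function.Embedding.subtype _), ?_⟩
  rw [← Finset.map_map, Finset.map_univ_equiv, Finset.univ_eq_attach]
  exact Finset.attach_map_val

theorem GenPos.signedArea_ne_zero {P : Finset (ℝ × ℝ)} (hP : GenPos P) {x y z : ℝ × ℝ}
    (hx : x ∈ P) (hy : y ∈ P) (hz : z ∈ P) (hxy : x ≠ y) (hxz : x ≠ z) (hyz : y ≠ z) :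
    signedArea x y z ≠ 0 :=
  fun h => hP x hx y hy z hz hxy hxz hyz (collinear_of_signedArea_eq_zero h)

open scoped Classical in
/-- Among five points in general position, the number of triples for which both remaining points
are β-points is `1` or `3` when the hull has four or three extreme points, and `0` otherwise. -/
theorem card_filter_isBetaPt {P S : Finset (ℝ × ℝ)} (hP : GenPos P) (hSP : S ⊆ P)
    (hS : S.card = 5) :
    ((S.powersetCard 3).filter fun T => ∀ x ∈ S \ T, IsBetaPt T x).card =
      (if (Set.extremePoints ℝ (convexHull ℝ (S : Set (ℝ × ℝ)))).ncard = 4 then 1 else 0) +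
        3 * (if (Set.extremePoints ℝ (convexHull ℝ (S : Set (ℝ × ℝ)))).ncard = 3
          then 1 else 0) := by
  obtain ⟨p, rfl⟩ := exists_map_univ_eq_of_card hS
  have hmem (i : Fin 5) : p i ∈ P := hSP (Finset.mem_map_of_mem p (Finset.mem_univ i))
  rw [ncard_extremePoints_map, ← card_filter_insideTriangle fun i j k hij hjk =>
    hP.signedArea_ne_zero (hmem i) (hmem j) (hmem k) (p.injective.ne hij.ne)
      (p.injective.ne (hij.trans hjk).ne) (p.injective.ne hjk.ne),
    Finset.powersetCard_map, Finset.filter_map, Finset.card_map]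
  congr 1
  refine Finset.filter_congr fun U hU => ?_
  rw [Finset.mem_powersetCard_univ] at hU
  have hother (i : Fin 5) (hi : i ∉ U) : ∃ m ∉ U, m ≠ i := by
    clear hmem
    decide +revert
  simp only [Function.comp_apply, RelEmbedding.coe_toEmbedding, Finset.mapEmbedding_apply,
    Finset.mem_sdiff, Finset.mem_map, Finset.mem_univ, true_and, and_imp, forall_exists_index,
    forall_apply_eq_imp_iff, EmbeddingLike.apply_eq_iff_eq, exists_eq_right]
  constructor
  · exact fun h i hi m hm hmi => (isBetaPt_map_iff hU hi hm hmi).1 (h i hi)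
  · intro h i hi
    obtain ⟨m, hm, hmi⟩ := hother i hi
    exact (isBetaPt_map_iff hU hi hm hmi).2 (h i hi m hm hmi)

open scoped Classical in
theorem choose_betaCount_eq_card_filter {P T : Finset (ℝ × ℝ)} (hTP : T ⊆ P) (hT : T.card = 3) :
    (betaCount P T).choose 2 =
      ((P.powersetCard 5).filter fun S => T ⊆ S ∧ ∀ x ∈ S \ T, IsBetaPt T x).card := by
  rw [betaCount, ← Finset.card_powersetCard]
  refine Finset.card_bij' (fun U _ => T ∪ U) (fun S _ => S \ T) ?_ ?_ ?_ ?_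
  · intro U hU
    obtain ⟨hU, hcard⟩ := Finset.mem_powersetCard.1 hU
    have hU' : ∀ x ∈ U, (x ∈ P ∧ x ∉ T) ∧ IsBetaPt T x := fun x hx => by
      simpa using hU hx
    have hdisj : Disjoint T U := Finset.disjoint_right.2 fun x hx => (hU' x hx).1.2
    simp only [Finset.mem_filter, Finset.mem_powersetCard]
    refine ⟨⟨Finset.union_subset hTP fun x hx => (hU' x hx).1.1, ?_⟩, Finset.subset_union_left, ?_⟩
    · rw [Finset.card_union_of_disjoint hdisj, hT, hcard]
    · intro x hx
      rw [Finset.union_sdiff_cancel_left hdisj] at hx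
      exact (hU' x hx).2
  · intro S hS
    simp only [Finset.mem_filter, Finset.mem_powersetCard] at hS
    obtain ⟨⟨hSP, hcard⟩, hTS, hβ⟩ := hS
    rw [Finset.mem_powersetCard, Finset.card_sdiff_of_subset hTS, hcard, hT]
    refine ⟨fun x hx => ?_, rfl⟩
    rw [Finset.mem_filter]
    exact ⟨Finset.sdiff_subset_sdiff hSP subset_rfl hx, hβ x hx⟩
  · intro U hU
    refine Finset.union_sdiff_cancel_left (Finset.disjoint_right.2 fun x hx => ?_)
    have := (Finset.mem_powersetCard.1 hU).1 hx
    simp only [Finset.mem_filter, Finset.mem_sdiff] at this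
    exact this.1.2
  · intro S hS
    exact Finset.union_sdiff_of_subset (Finset.mem_filter.1 hS).2.1

open scoped Classical in
theorem hullCount_eq_card_filter (P : Finset (ℝ × ℝ)) (k j : ℕ) :
    hullCount P k j = ((P.powersetCard k).filter fun S : Finset (ℝ × ℝ) =>
      (Set.extremePoints ℝ (convexHull ℝ (S : Set (ℝ × ℝ)))).ncard = j).card := by
  have himage : (do let S ← P.powersetCard k; pure (S : Set (ℝ × ℝ))) =
      (P.powersetCard k).map ⟨((↑) : Finset (ℝ × ℝ) → Set (ℝ × ℝ)), Finset.coe_injective⟩ := by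
    ext S
    simp
  rw [hullCount, himage, Finset.filter_map, Finset.card_map]
  rfl

/-- For any point placement `P`, `∑_T C(β_T, 2) = U(P) + 3·T₂(P)`. -/
theorem sum_beta_choose_two (P : Finset (ℝ × ℝ)) (n : ℕ) (hgp : GenPos P)
    (hcard : P.card = n) :
    ∑ T ∈ P.powersetCard 3, (betaCount P T).choose 2 =
      hullCount P 5 4 + 3 * hullCount P 5 3 := by
  classical
  calc ∑ T ∈ P.powersetCard 3, (betaCount P T).choose 2
    _ = ∑ T ∈ P.powersetCard 3,
        ((P.powersetCard 5).filter fun S => T ⊆ S ∧ ∀ x ∈ S \ T, IsBetaPt T x).card :=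
      Finset.sum_congr rfl fun T hT =>
        choose_betaCount_eq_card_filter (Finset.mem_powersetCard.1 hT).1
          (Finset.mem_powersetCard.1 hT).2
    _ = ∑ S ∈ P.powersetCard 5,
        ((P.powersetCard 3).filter fun T => T ⊆ S ∧ ∀ x ∈ S \ T, IsBetaPt T x).card :=
      Finset.sum_card_bipartiteAbove_eq_sum_card_bipartiteBelow _
    _ = ∑ S ∈ P.powersetCard 5,
        ((S.powersetCard 3).filter fun T => ∀ x ∈ S \ T, IsBetaPt T x).card := by
      refine Finset.sum_congr rfl fun S hS => congrArg Finset.card ?_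
      have hSP := (Finset.mem_powersetCard.1 hS).1
      ext T
      simp only [Finset.mem_filter, Finset.mem_powersetCard]
      exact ⟨fun h => ⟨⟨h.2.1, h.1.2⟩, h.2.2⟩,
        fun h => ⟨⟨h.1.1.trans hSP, h.1.2⟩, h.1.1, h.2⟩⟩
    _ = hullCount P 5 4 + 3 * hullCount P 5 3 := by
      rw [hullCount_eq_card_filter, hullCount_eq_card_filter, Finset.card_filter, Finset.card_filter, Finset.mul_sum,
        ← Finset.sum_add_distrib]
      exact Finset.sum_congr rfl fun S hS =>
        card_filter_isBetaPt hgp (Finset.mem_powersetCard.1 hS).1 (Finset.mem_powersetCard.1 hS).2
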